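/- arXiv:2211.15249 — 3 statements merged into one kernel-verified Lean document; each statement's English description precedes it below -/
import Mathlib

section
/- Let Γ be a group generated by a finite set S. Then Γ is locally stable if and only if every stability challenge for Γ has a local solution; and Γ is weakly locally stable if and only if every separating stability challenge for Γ has a local solution. -/
open Filter Topology

open scoped Classical

/-- Normalized Hamming metric on `Sym(k)`:
`d_k(σ,τ) = |{i : σ i ≠ τ i}| / k` (which equals `1 - |{i : σ i = τ i}|/k` for `k ≥ 1`). -/
noncomputable def dHam {k : ℕ} (σ τ : Equiv.Perm (Fin k)) : ℝ :=
  ((Finset.univ.filter fun i => σ i ≠ τ i).card : ℝ) / k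

/-- `(φ_n)` is an almost-homomorphism. -/
def IsAlmostHom {Γ : Type*} [Group Γ] (k : ℕ → ℕ)
    (φ : ∀ n, Γ → Equiv.Perm (Fin (k n))) : Prop :=
  ∀ g h : Γ,
    Tendsto (fun n => dHam (φ n g * φ n h) (φ n (g * h))) atTop (𝓝 0)

/-- `(φ_n)` is a partial homomorphism. -/
def IsPartialHom {Γ : Type*} [Group Γ] (k : ℕ → ℕ)
    (φ : ∀ n, Γ → Equiv.Perm (Fin (k n))) : Prop :=
  ∀ g h : Γ, ∀ᶠ n in atTop, φ n (g * h) = φ n g * φ n h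

/-- `(φ_n)` is separating. -/
def IsSeparating {Γ : Type*} [Group Γ] (k : ℕ → ℕ)
    (φ : ∀ n, Γ → Equiv.Perm (Fin (k n))) : Prop :=
  ∀ g : Γ, g ≠ 1 → Tendsto (fun n => dHam (φ n g) 1) atTop (𝓝 1)

/-- `(φ_n)` is a sequence of genuine homomorphisms. -/
def IsHomSeq {Γ : Type*} [Group Γ] (k : ℕ → ℕ)
    (φ : ∀ n, Γ → Equiv.Perm (Fin (k n))) : Prop :=
  ∀ n, ∀ g h : Γ, φ n (g * h) = φ n g * φ n h

/-- `(ψ_n)` is asymptotically close to `(φ_n)`: for every `g`, `d_{k_n}(φ_n g, ψ_n g) → 0`. -/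
def CloseSeq {Γ : Type*} [Group Γ] (k : ℕ → ℕ)
    (φ ψ : ∀ n, Γ → Equiv.Perm (Fin (k n))) : Prop :=
  ∀ g : Γ, Tendsto (fun n => dHam (φ n g) (ψ n g)) atTop (𝓝 0)

/-- `Γ` is locally stable. -/
def IsLocallyStable (Γ : Type*) [Group Γ] : Prop :=
  ∀ (k : ℕ → ℕ), (∀ n, 0 < k n) →
    ∀ φ : ∀ n, Γ → Equiv.Perm (Fin (k n)), IsAlmostHom k φ →
      ∃ ψ : ∀ n, Γ → Equiv.Perm (Fin (k n)), IsPartialHom k ψ ∧ CloseSeq k φ ψ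

/-- `Γ` is weakly locally stable. -/
def IsWeaklyLocallyStable (Γ : Type*) [Group Γ] : Prop :=
  ∀ (k : ℕ → ℕ), (∀ n, 0 < k n) →
    ∀ φ : ∀ n, Γ → Equiv.Perm (Fin (k n)), IsAlmostHom k φ → IsSeparating k φ →
      ∃ ψ : ∀ n, Γ → Equiv.Perm (Fin (k n)), IsPartialHom k ψ ∧ CloseSeq k φ ψ

/-- `Γ` is stable (in permutations). -/
def IsStable (Γ : Type*) [Group Γ] : Prop :=
  ∀ (k : ℕ → ℕ), (∀ n, 0 < k n) →
    ∀ φ : ∀ n, Γ → Equiv.Perm (Fin (k n)), IsAlmostHom k φ →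
      ∃ ψ : ∀ n, Γ → Equiv.Perm (Fin (k n)), IsHomSeq k ψ ∧ CloseSeq k φ ψ

/-- `Γ` is weakly stable. -/
def IsWeaklyStable (Γ : Type*) [Group Γ] : Prop :=
  ∀ (k : ℕ → ℕ), (∀ n, 0 < k n) →
    ∀ φ : ∀ n, Γ → Equiv.Perm (Fin (k n)), IsAlmostHom k φ → IsSeparating k φ →
      ∃ ψ : ∀ n, Γ → Equiv.Perm (Fin (k n)), IsHomSeq k ψ ∧ CloseSeq k φ ψ

/-- `Γ` is sofic: it admits a separating almost-homomorphism. -/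
def IsSofic (Γ : Type*) [Group Γ] : Prop :=
  ∃ (k : ℕ → ℕ), (∀ n, 0 < k n) ∧
    ∃ φ : ∀ n, Γ → Equiv.Perm (Fin (k n)), IsAlmostHom k φ ∧ IsSeparating k φ

/-- `Γ` is LEF: it admits a separating partial homomorphism. -/
def IsLEF (Γ : Type*) [Group Γ] : Prop :=
  ∃ (k : ℕ → ℕ), (∀ n, 0 < k n) ∧
    ∃ φ : ∀ n, Γ → Equiv.Perm (Fin (k n)), IsPartialHom k φ ∧ IsSeparating k φ

/-- Proportion of points moved by a permutation of `Fin k`. -/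
noncomputable def probMoved {k : ℕ} (σ : Equiv.Perm (Fin k)) : ℝ :=
  ((Finset.univ.filter fun x => σ x ≠ x).card : ℝ) / k

/-- `‖f‖_gen` for a bijection `f` between two finite `F`-sets (both modelled on `Fin k`),
where `F` is the free group on the finite set `ι`. -/
noncomputable def normGen {ι : Type} [Fintype ι] {k : ℕ}
    (a b : FreeGroup ι →* Equiv.Perm (Fin k)) (f : Equiv.Perm (Fin k)) : ℝ :=
  (1 / (Fintype.card ι : ℝ)) * ∑ i : ι,
    ((Finset.univ.filter fun x =>
        f (a (FreeGroup.of i) x) ≠ b (FreeGroup.of i) (f x)).card : ℝ) / k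

/-- `d_gen(X,Y)`: the minimal value of `‖f‖_gen` over bijections `f : X → Y`. -/
noncomputable def dGen {ι : Type} [Fintype ι] {k : ℕ}
    (a b : FreeGroup ι →* Equiv.Perm (Fin k)) : ℝ :=
  sInf (Set.range fun f : Equiv.Perm (Fin k) => normGen a b f)

/-- A stability challenge for `Γ` (marked by `π : F → Γ`): a sequence of finite `F`-sets
such that every `r ∈ ker π` asymptotically moves a vanishing proportion of points. -/
def IsStabilityChallenge {ι : Type} [Fintype ι] {Γ : Type*} [Group Γ]
    (π : FreeGroup ι →* Γ) (k : ℕ → ℕ)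
    (a : ∀ n, FreeGroup ι →* Equiv.Perm (Fin (k n))) : Prop :=
  ∀ r ∈ π.ker, Tendsto (fun n => probMoved (a n r)) atTop (𝓝 0)

/-- The stability challenge is separating: every `w ∉ ker π` asymptotically moves almost
all points. -/
def IsSeparatingChallenge {ι : Type} [Fintype ι] {Γ : Type*} [Group Γ]
    (π : FreeGroup ι →* Γ) (k : ℕ → ℕ)
    (a : ∀ n, FreeGroup ι →* Equiv.Perm (Fin (k n))) : Prop :=
  ∀ w : FreeGroup ι, w ∉ π.ker → Tendsto (fun n => probMoved (a n w)) atTop (𝓝 1)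

/-- `(Y_n)` is a local `Γ`-set: every `r ∈ ker π` acts trivially for all large `n`. -/
def IsLocalGammaSet {ι : Type} [Fintype ι] {Γ : Type*} [Group Γ]
    (π : FreeGroup ι →* Γ) (k : ℕ → ℕ)
    (b : ∀ n, FreeGroup ι →* Equiv.Perm (Fin (k n))) : Prop :=
  ∀ r ∈ π.ker, ∀ᶠ n in atTop, b n r = 1

/-- `(Y_n)` is a local solution to the stability challenge `(X_n)`: it is a local
`Γ`-set of the same sizes with `d_gen(X_n, Y_n) → 0`. -/
def IsLocalSolution {ι : Type} [Fintype ι] {Γ : Type*} [Group Γ]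
    (π : FreeGroup ι →* Γ) (k : ℕ → ℕ)
    (a b : ∀ n, FreeGroup ι →* Equiv.Perm (Fin (k n))) : Prop :=
  IsLocalGammaSet π k b ∧ Tendsto (fun n => dGen (a n) (b n)) atTop (𝓝 0)

section HammingDistance

variable {k : ℕ}

theorem dHam_eq_hammingDist (σ τ : Equiv.Perm (Fin k)) :
    dHam σ τ = (hammingDist (σ : Fin k → Fin k) τ : ℝ) / k := by
  unfold dHam hammingDist
  congr!

theorem dHam_nonneg (σ τ : Equiv.Perm (Fin k)) : 0 ≤ dHam σ τ := by
  unfold dHam; positivity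

theorem dHam_self (σ : Equiv.Perm (Fin k)) : dHam σ σ = 0 := by
  simp [dHam_eq_hammingDist]

theorem dHam_comm (σ τ : Equiv.Perm (Fin k)) : dHam σ τ = dHam τ σ := by
  rw [dHam_eq_hammingDist, dHam_eq_hammingDist, hammingDist_comm]

theorem dHam_triangle (σ τ ρ : Equiv.Perm (Fin k)) : dHam σ ρ ≤ dHam σ τ + dHam τ ρ := by
  simp only [dHam_eq_hammingDist, ← add_div]
  gcongr
  exact_mod_cast hammingDist_triangle (σ : Fin k → Fin k) τ ρ

theorem dHam_mul_left (ρ σ τ : Equiv.Perm (Fin k)) : dHam (ρ * σ) (ρ * τ) = dHam σ τ := by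
  simp [dHam]

theorem dHam_mul_right (ρ σ τ : Equiv.Perm (Fin k)) : dHam (σ * ρ) (τ * ρ) = dHam σ τ := by
  unfold dHam
  congr 2
  refine Finset.card_equiv ρ fun i => ?_
  rw [Finset.mem_filter, Finset.mem_filter]
  simp

end HammingDistance

section Sequences

variable (k : ℕ → ℕ)

/-- The sequences of permutations asymptotically moving a vanishing proportion of points. -/
def nullSequences : Subgroup (∀ n, Equiv.Perm (Fin (k n))) where
  carrier := {σ | Tendsto (fun n => dHam (σ n) 1) atTop (𝓝 0)}
  one_mem' := by simp [dHam_self]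
  mul_mem' {σ τ} hσ hτ := by
    refine squeeze_zero (fun n => dHam_nonneg _ _) (fun n => ?_) (by simpa using hσ.add hτ)
    calc dHam (σ n * τ n) 1 ≤ dHam (σ n * τ n) (1 * τ n) + dHam (1 * τ n) 1 := dHam_triangle _ _ _
      _ = dHam (σ n) 1 + dHam (τ n) 1 := by rw [dHam_mul_right, one_mul]
  inv_mem' {σ} hσ := by
    refine Tendsto.congr (fun n => ?_) hσ
    rw [Pi.inv_apply, ← dHam_mul_left (σ n) (σ n)⁻¹, mul_inv_cancel, mul_one, dHam_comm]

instance : (nullSequences k).Normal where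
  conj_mem σ hσ τ := by
    refine Tendsto.congr (fun n => ?_) hσ
    rw [Pi.mul_apply, Pi.mul_apply, Pi.inv_apply, ← dHam_mul_right (τ n) (_ * _), one_mul,
      inv_mul_cancel_right, ← dHam_mul_left (τ n), mul_one]

/-- The sequences of permutations that are eventually trivial. -/
def eventuallyOneSequences : Subgroup (∀ n, Equiv.Perm (Fin (k n))) where
  carrier := {σ | ∀ᶠ n in atTop, σ n = 1}
  one_mem' := by simp
  mul_mem' hσ hτ := by
    filter_upwards [hσ, hτ] with n h h'
    simp [h, h']
  inv_mem' hσ := by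
    filter_upwards [hσ] with n h
    simp [h]

instance : (eventuallyOneSequences k).Normal where
  conj_mem σ hσ τ := by
    filter_upwards [hσ] with n h
    simp [h]

variable {k}

theorem mk_nullSequences_eq_iff {σ τ : ∀ n, Equiv.Perm (Fin (k n))} :
    (σ : _ ⧸ nullSequences k) = τ ↔ Tendsto (fun n => dHam (σ n) (τ n)) atTop (𝓝 0) := by
  rw [QuotientGroup.eq]
  refine tendsto_congr fun n => ?_
  rw [← dHam_mul_left (σ n), Pi.mul_apply, Pi.inv_apply, mul_inv_cancel_left, mul_one, dHam_comm]

theorem mk_eventuallyOneSequences_eq_iff {σ τ : ∀ n, Equiv.Perm (Fin (k n))} :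
    (σ : _ ⧸ eventuallyOneSequences k) = τ ↔ ∀ᶠ n in atTop, σ n = τ n := by
  rw [QuotientGroup.eq]
  refine eventually_congr (Eventually.of_forall fun n => ?_)
  rw [Pi.mul_apply, Pi.inv_apply, inv_mul_eq_one]

theorem tendsto_dHam_one_of_mk_eq {σ τ : ∀ n, Equiv.Perm (Fin (k n))}
    (h : (σ : _ ⧸ nullSequences k) = τ) (hσ : Tendsto (fun n => dHam (σ n) 1) atTop (𝓝 1)) :
    Tendsto (fun n => dHam (τ n) 1) atTop (𝓝 1) := by
  rw [mk_nullSequences_eq_iff] at h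
  refine tendsto_of_tendsto_of_tendsto_of_le_of_le (by simpa using hσ.sub h)
    (by simpa using hσ.add h) (fun n => ?_) (fun n => ?_)
  · have := dHam_triangle (σ n) (τ n) 1
    simp only
    linarith
  · have := dHam_triangle (τ n) (σ n) 1
    rw [dHam_comm (τ n) (σ n)] at this
    simp only
    linarith

end Sequences

section Groups

variable {Γ P : Type*} [Group Γ] [Group P] (N : Subgroup P) [N.Normal]

theorem mk_section_mul {F : Type*} [Group F] (π : F →* Γ) (a : F →* P)
    (ha : ∀ r ∈ π.ker, (a r : P ⧸ N) = 1) {s : Γ → F} (hs : ∀ g, π (s g) = g) (g h : Γ) :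
    ((a (s g) * a (s h) : P) : P ⧸ N) = a (s (g * h)) := by
  have := ha ((s g * s h)⁻¹ * s (g * h)) (by simp [MonoidHom.mem_ker, hs])
  rwa [map_mul, map_inv, QuotientGroup.mk_mul, QuotientGroup.mk_inv, inv_mul_eq_one, map_mul]
    at this

theorem mk_hom_eq_of_generators {ι : Type} (π : FreeGroup ι →* Γ) (a : FreeGroup ι →* P) (φ : Γ → P)
    (hφ : ∀ g h, ((φ g * φ h : P) : P ⧸ N) = φ (g * h))
    (ha : ∀ i, (a (FreeGroup.of i) : P ⧸ N) = φ (π (FreeGroup.of i))) (w : FreeGroup ι) :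
    (a w : P ⧸ N) = φ (π w) := by
  let φ' : Γ →* P ⧸ N := MonoidHom.mk' (fun g => (φ g : P ⧸ N)) fun g h => (hφ g h).symm
  have : (QuotientGroup.mk' N).comp a = φ'.comp π := FreeGroup.ext_hom _ _ ha
  exact DFunLike.congr_fun this w

end Groups

section GeneratorDistance

variable {ι : Type} [Fintype ι] {k : ℕ} (a b : FreeGroup ι →* Equiv.Perm (Fin k))

theorem normGen_eq_sum_dHam (f : Equiv.Perm (Fin k)) :
    normGen a b f = (1 / (Fintype.card ι : ℝ)) *
      ∑ i, dHam (a (FreeGroup.of i)) (f⁻¹ * b (FreeGroup.of i) * f) := by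
  unfold normGen
  congr 1
  refine Finset.sum_congr rfl fun i _ => ?_
  rw [← dHam_mul_left f, ← mul_assoc, mul_inv_cancel_left]
  rfl

theorem normGen_nonneg (f : Equiv.Perm (Fin k)) : 0 ≤ normGen a b f := by
  rw [normGen_eq_sum_dHam]
  have := Finset.sum_nonneg fun i (_ : i ∈ Finset.univ) =>
    dHam_nonneg (a (FreeGroup.of i)) (f⁻¹ * b (FreeGroup.of i) * f)
  positivity

theorem dGen_nonneg : 0 ≤ dGen a b :=
  Real.sInf_nonneg (by rintro _ ⟨f, rfl⟩; exact normGen_nonneg a b f)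

theorem dGen_le_normGen (f : Equiv.Perm (Fin k)) : dGen a b ≤ normGen a b f :=
  csInf_le (Set.finite_range _).bddBelow ⟨f, rfl⟩

theorem exists_normGen_eq_dGen : ∃ f, normGen a b f = dGen a b :=
  (Set.range_nonempty _).csInf_mem (Set.finite_range _)

theorem dHam_le_card_mul_normGen (f : Equiv.Perm (Fin k)) (i : ι) :
    dHam (a (FreeGroup.of i)) (f⁻¹ * b (FreeGroup.of i) * f) ≤
      Fintype.card ι * normGen a b f := by
  have : Nonempty ι := ⟨i⟩
  rw [normGen_eq_sum_dHam, ← mul_assoc, mul_one_div_cancel (by simp), one_mul]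
  exact Finset.single_le_sum
    (f := fun i => dHam (a (FreeGroup.of i)) (f⁻¹ * b (FreeGroup.of i) * f))
    (fun _ _ => dHam_nonneg _ _) (Finset.mem_univ i)

end GeneratorDistance

section Challenges

variable {ι : Type} {Γ : Type*} [Group Γ] {π : FreeGroup ι →* Γ} {k : ℕ → ℕ}

theorem isAlmostHom_iff_mk {φ : ∀ n, Γ → Equiv.Perm (Fin (k n))} :
    IsAlmostHom k φ ↔ ∀ g h, (((fun n => φ n g) * (fun n => φ n h) :
      ∀ n, Equiv.Perm (Fin (k n))) : _ ⧸ nullSequences k) = (fun n => φ n (g * h) :) :=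
  forall₂_congr fun _ _ => mk_nullSequences_eq_iff.symm

theorem isPartialHom_iff_mk {φ : ∀ n, Γ → Equiv.Perm (Fin (k n))} :
    IsPartialHom k φ ↔ ∀ g h, (((fun n => φ n g) * (fun n => φ n h) :
      ∀ n, Equiv.Perm (Fin (k n))) : _ ⧸ eventuallyOneSequences k) = (fun n => φ n (g * h) :) :=
  forall₂_congr fun _ _ => by
    rw [mk_eventuallyOneSequences_eq_iff]
    exact eventually_congr (Eventually.of_forall fun _ => eq_comm)

/-- The action of the free group in which each generator acts through its image under `φ`. -/
def freeAction (π : FreeGroup ι →* Γ) (φ : ∀ n, Γ → Equiv.Perm (Fin (k n))) (n : ℕ) :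
    FreeGroup ι →* Equiv.Perm (Fin (k n)) :=
  FreeGroup.lift fun i => φ n (π (FreeGroup.of i))

theorem freeAction_of (φ : ∀ n, Γ → Equiv.Perm (Fin (k n))) (n : ℕ) (i : ι) :
    freeAction π φ n (FreeGroup.of i) = φ n (π (FreeGroup.of i)) :=
  FreeGroup.lift_apply_of

theorem IsAlmostHom.mk_freeAction {φ : ∀ n, Γ → Equiv.Perm (Fin (k n))} (hφ : IsAlmostHom k φ)
    (w : FreeGroup ι) :
    (MonoidHom.pi (freeAction π φ) w : _ ⧸ nullSequences k) = (fun n => φ n (π w) :) := by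
  refine mk_hom_eq_of_generators _ π _ (fun g n => φ n g) (isAlmostHom_iff_mk.1 hφ)
    (fun i => congrArg _ (funext fun n => ?_)) w
  exact freeAction_of φ n i

theorem IsPartialHom.mk_freeAction {φ : ∀ n, Γ → Equiv.Perm (Fin (k n))} (hφ : IsPartialHom k φ)
    (w : FreeGroup ι) :
    (MonoidHom.pi (freeAction π φ) w : _ ⧸ eventuallyOneSequences k) = (fun n => φ n (π w) :) := by
  refine mk_hom_eq_of_generators _ π _ (fun g n => φ n g) (isPartialHom_iff_mk.1 hφ)
    (fun i => congrArg _ (funext fun n => ?_)) w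
  exact freeAction_of φ n i

variable [Fintype ι]

theorem isStabilityChallenge_iff_mk {a : ∀ n, FreeGroup ι →* Equiv.Perm (Fin (k n))} :
    IsStabilityChallenge π k a ↔
      ∀ r ∈ π.ker, (MonoidHom.pi a r : _ ⧸ nullSequences k) = 1 :=
  forall₂_congr fun _ _ => (mk_nullSequences_eq_iff (τ := 1)).symm

theorem isLocalGammaSet_iff_mk {b : ∀ n, FreeGroup ι →* Equiv.Perm (Fin (k n))} :
    IsLocalGammaSet π k b ↔
      ∀ r ∈ π.ker, (MonoidHom.pi b r : _ ⧸ eventuallyOneSequences k) = 1 :=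
  forall₂_congr fun _ _ => (mk_eventuallyOneSequences_eq_iff (τ := 1)).symm

theorem IsStabilityChallenge.isAlmostHom_section
    {a : ∀ n, FreeGroup ι →* Equiv.Perm (Fin (k n))} (ha : IsStabilityChallenge π k a)
    {s : Γ → FreeGroup ι} (hs : ∀ g, π (s g) = g) : IsAlmostHom k fun n g => a n (s g) :=
  isAlmostHom_iff_mk.2 <| mk_section_mul _ π (MonoidHom.pi a) (isStabilityChallenge_iff_mk.1 ha) hs

theorem IsLocalGammaSet.isPartialHom_section
    {b : ∀ n, FreeGroup ι →* Equiv.Perm (Fin (k n))} (hb : IsLocalGammaSet π k b)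
    {s : Γ → FreeGroup ι} (hs : ∀ g, π (s g) = g) : IsPartialHom k fun n g => b n (s g) :=
  isPartialHom_iff_mk.2 <| mk_section_mul _ π (MonoidHom.pi b) (isLocalGammaSet_iff_mk.1 hb) hs

theorem IsSeparatingChallenge.isSeparating_section
    {a : ∀ n, FreeGroup ι →* Equiv.Perm (Fin (k n))} (ha : IsSeparatingChallenge π k a)
    {s : Γ → FreeGroup ι} (hs : ∀ g, π (s g) = g) : IsSeparating k fun n g => a n (s g) :=
  fun g hg => ha (s g) (by rwa [MonoidHom.mem_ker, hs])

theorem IsAlmostHom.isStabilityChallenge_freeAction {φ : ∀ n, Γ → Equiv.Perm (Fin (k n))}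
    (hφ : IsAlmostHom k φ) : IsStabilityChallenge π k (freeAction π φ) := by
  rw [isStabilityChallenge_iff_mk]
  intro r hr
  rw [hφ.mk_freeAction, hr, ← map_one π, ← hφ.mk_freeAction, map_one, QuotientGroup.mk_one]

theorem IsPartialHom.isLocalGammaSet_freeAction {φ : ∀ n, Γ → Equiv.Perm (Fin (k n))}
    (hφ : IsPartialHom k φ) : IsLocalGammaSet π k (freeAction π φ) := by
  rw [isLocalGammaSet_iff_mk]
  intro r hr
  rw [hφ.mk_freeAction, hr, ← map_one π, ← hφ.mk_freeAction, map_one, QuotientGroup.mk_one]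

theorem IsAlmostHom.isSeparatingChallenge_freeAction {φ : ∀ n, Γ → Equiv.Perm (Fin (k n))}
    (hφ : IsAlmostHom k φ) (h : IsSeparating k φ) :
    IsSeparatingChallenge π k (freeAction π φ) :=
  fun w hw => tendsto_dHam_one_of_mk_eq (hφ.mk_freeAction w).symm (h (π w) hw)

theorem tendsto_dGen_of_generators {a b : ∀ n, FreeGroup ι →* Equiv.Perm (Fin (k n))}
    (h : ∀ i, Tendsto (fun n => dHam (a n (FreeGroup.of i)) (b n (FreeGroup.of i))) atTop (𝓝 0)) :
    Tendsto (fun n => dGen (a n) (b n)) atTop (𝓝 0) := by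
  refine squeeze_zero (fun n => dGen_nonneg _ _) (fun n => dGen_le_normGen _ _ 1) ?_
  simp only [normGen_eq_sum_dHam, inv_one, one_mul, mul_one]
  simpa using (tendsto_finsetSum Finset.univ fun i _ => h i).const_mul (1 / (Fintype.card ι : ℝ))

theorem IsStabilityChallenge.isLocalSolution_freeAction
    {a : ∀ n, FreeGroup ι →* Equiv.Perm (Fin (k n))} (ha : IsStabilityChallenge π k a)
    {s : Γ → FreeGroup ι} (hs : ∀ g, π (s g) = g) {ψ : ∀ n, Γ → Equiv.Perm (Fin (k n))}
    (hψ : IsPartialHom k ψ) (hclose : CloseSeq k (fun n g => a n (s g)) ψ) :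
    IsLocalSolution π k a (freeAction π ψ) := by
  refine ⟨hψ.isLocalGammaSet_freeAction, tendsto_dGen_of_generators fun i => ?_⟩
  have key := isStabilityChallenge_iff_mk.1 ha
    ((FreeGroup.of i)⁻¹ * s (π (FreeGroup.of i))) (by simp [MonoidHom.mem_ker, hs])
  rw [map_mul, map_inv, QuotientGroup.mk_mul, QuotientGroup.mk_inv, inv_mul_eq_one] at key
  simp only [freeAction_of]
  exact mk_nullSequences_eq_iff.1 (key.trans (mk_nullSequences_eq_iff.2 (hclose _)))

theorem IsLocalSolution.exists_close {a b : ∀ n, FreeGroup ι →* Equiv.Perm (Fin (k n))}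
    (h : IsLocalSolution π k a b) :
    ∃ b' : ∀ n, FreeGroup ι →* Equiv.Perm (Fin (k n)), IsLocalGammaSet π k b' ∧
      ∀ w, (MonoidHom.pi a w : _ ⧸ nullSequences k) = MonoidHom.pi b' w := by
  choose f hf using fun n => exists_normGen_eq_dGen (a n) (b n)
  refine ⟨fun n => (MulAut.conj (f n)⁻¹).toMonoidHom.comp (b n), fun r hr => ?_, ?_⟩
  · filter_upwards [h.1 r hr] with n hn
    simp [hn]
  · intro w
    refine mk_hom_eq_of_generators _ (MonoidHom.id _) _ (fun w => MonoidHom.pi _ w)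
      (fun g h => by rw [map_mul]) (fun i => mk_nullSequences_eq_iff.2 ?_) w
    refine squeeze_zero (fun n => dHam_nonneg _ _)
      (g := fun n => Fintype.card ι * dGen (a n) (b n)) (fun n => ?_)
      (by simpa using h.2.const_mul (Fintype.card ι : ℝ))
    rw [← hf n]
    have hconj (σ : Equiv.Perm (Fin (k n))) : MulAut.conj (f n)⁻¹ σ = (f n)⁻¹ * σ * f n := by simp
    exact (congrArg (dHam _) (hconj _)).trans_le (dHam_le_card_mul_normGen (a n) (b n) (f n) i)

theorem IsAlmostHom.exists_partialHom_of_isLocalSolution (hπ : Function.Surjective π)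
    {φ : ∀ n, Γ → Equiv.Perm (Fin (k n))} (hφ : IsAlmostHom k φ)
    {b : ∀ n, FreeGroup ι →* Equiv.Perm (Fin (k n))}
    (h : IsLocalSolution π k (freeAction π φ) b) :
    ∃ ψ : ∀ n, Γ → Equiv.Perm (Fin (k n)), IsPartialHom k ψ ∧ CloseSeq k φ ψ := by
  obtain ⟨s, hs⟩ := hπ.hasRightInverse
  obtain ⟨b', hb', hclose⟩ := h.exists_close
  refine ⟨_, hb'.isPartialHom_section hs, fun g => ?_⟩
  have key := (hφ.mk_freeAction (s g)).symm.trans (hclose (s g))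
  rw [hs] at key
  exact mk_nullSequences_eq_iff.1 key

end Challenges

/-- `Γ` is locally stable iff every stability challenge for `Γ` has a local solution, and
weakly locally stable iff every separating stability challenge has a local solution. -/
theorem locallyStable_iff_challenges (Γ : Type) [Group Γ] (S : Finset Γ)
    (hS : Subgroup.closure (S : Set Γ) = ⊤) :
    (IsLocallyStable Γ ↔
      ∀ (k : ℕ → ℕ), (∀ n, 0 < k n) →
        ∀ a : ∀ n, FreeGroup ↥S →* Equiv.Perm (Fin (k n)),
          IsStabilityChallenge (FreeGroup.lift fun s : ↥S => (s : Γ)) k a →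
          ∃ b, IsLocalSolution (FreeGroup.lift fun s : ↥S => (s : Γ)) k a b) ∧
    (IsWeaklyLocallyStable Γ ↔
      ∀ (k : ℕ → ℕ), (∀ n, 0 < k n) →
        ∀ a : ∀ n, FreeGroup ↥S →* Equiv.Perm (Fin (k n)),
          IsStabilityChallenge (FreeGroup.lift fun s : ↥S => (s : Γ)) k a →
          IsSeparatingChallenge (FreeGroup.lift fun s : ↥S => (s : Γ)) k a →
          ∃ b, IsLocalSolution (FreeGroup.lift fun s : ↥S => (s : Γ)) k a b) := by
  have hπ : Function.Surjective (FreeGroup.lift fun s : ↥S => (s : Γ)) := by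
    rw [← MonoidHom.range_eq_top, FreeGroup.range_lift_eq_closure, ← hS]
    simp
  obtain ⟨s, hs⟩ := hπ.hasRightInverse
  refine ⟨⟨fun H k hk a ha => ?_, fun H k hk φ hφ => ?_⟩,
    ⟨fun H k hk a ha ha' => ?_, fun H k hk φ hφ hφ' => ?_⟩⟩
  · obtain ⟨ψ, hψ, hclose⟩ := H k hk _ (ha.isAlmostHom_section hs)
    exact ⟨_, ha.isLocalSolution_freeAction hs hψ hclose⟩
  · obtain ⟨b, hb⟩ := H k hk _ hφ.isStabilityChallenge_freeAction
    exact hφ.exists_partialHom_of_isLocalSolution hπ hb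
  · obtain ⟨ψ, hψ, hclose⟩ := H k hk _ (ha.isAlmostHom_section hs) (ha'.isSeparating_section hs)
    exact ⟨_, ha.isLocalSolution_freeAction hs hψ hclose⟩
  · obtain ⟨b, hb⟩ := H k hk _ hφ.isStabilityChallenge_freeAction
      (hφ.isSeparatingChallenge_freeAction hφ')
    exact hφ.exists_partialHom_of_isLocalSolution hπ hb
end

section
/- If Γ is a finitely presented group which is locally stable, then Γ is stable; and if Γ is finitely presented and weakly locally stable, then Γ is weakly stable. -/
open Filter Topology

open scoped Classical

/-- `Γ` is finitely presented: it is isomorphic to the quotient of a finitely generated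
free group by the normal closure of a finite set. -/
def IsFinitelyPresented (Γ : Type*) [Group Γ] : Prop :=
  ∃ (d : ℕ) (R : Finset (FreeGroup (Fin d))),
    Nonempty
      ((FreeGroup (Fin d) ⧸ Subgroup.normalClosure (R : Set (FreeGroup (Fin d)))) ≃* Γ)

/-- Along a partial homomorphism, the value at the image of a word of the free group is eventually
the value of that word on the images of the generators. -/
theorem IsPartialHom.eventually_lift_eq {Γ : Type*} [Group Γ] {k : ℕ → ℕ}
    {ψ : ∀ n, Γ → Equiv.Perm (Fin (k n))} (hψ : IsPartialHom k ψ) {α : Type*}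
    (p : FreeGroup α →* Γ) (w : FreeGroup α) :
    ∀ᶠ n in atTop, FreeGroup.lift (fun a => ψ n (p (FreeGroup.of a))) w = ψ n (p w) := by
  have h_one : ∀ᶠ n in atTop, ψ n 1 = 1 := by
    filter_upwards [hψ 1 1] with n hn
    simpa using hn
  induction w using FreeGroup.induction_on with
  | C1 =>
    filter_upwards [h_one] with n hn
    simp [hn]
  | of a => exact Eventually.of_forall fun n => by simp
  | inv_of a ih =>
    filter_upwards [h_one, hψ (p (FreeGroup.of a))⁻¹ (p (FreeGroup.of a))] with n h1 h2
    rw [inv_mul_cancel, h1] at h2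
    simpa using (eq_inv_of_mul_eq_one_left h2.symm).symm
  | mul x y hx hy =>
    filter_upwards [hx, hy, hψ (p x) (p y)] with n h1 h2 h3
    rw [map_mul, map_mul, h1, h2, h3]

/-- A partial homomorphism from a finitely presented group agrees eventually, at every element,
with a sequence of genuine homomorphisms. -/
theorem IsPartialHom.exists_isHomSeq_eventually_eq {Γ : Type*} [Group Γ]
    (hfp : IsFinitelyPresented Γ) {k : ℕ → ℕ} {ψ : ∀ n, Γ → Equiv.Perm (Fin (k n))}
    (hψ : IsPartialHom k ψ) :
    ∃ χ : ∀ n, Γ → Equiv.Perm (Fin (k n)),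
      IsHomSeq k χ ∧ ∀ g, ∀ᶠ n in atTop, χ n g = ψ n g := by
  obtain ⟨d, R, ⟨e⟩⟩ := hfp
  let N := Subgroup.normalClosure (R : Set (FreeGroup (Fin d)))
  let p : FreeGroup (Fin d) →* Γ := e.toMonoidHom.comp (QuotientGroup.mk' N)
  let L (n : ℕ) : FreeGroup (Fin d) →* Equiv.Perm (Fin (k n)) :=
    FreeGroup.lift fun a => ψ n (p (FreeGroup.of a))
  have hL (w : FreeGroup (Fin d)) : ∀ᶠ n in atTop, L n w = ψ n (p w) :=
    hψ.eventually_lift_eq p w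
  have h_rel : ∀ᶠ n in atTop, N ≤ (L n).ker := by
    have h_all : ∀ᶠ n in atTop, ∀ r ∈ R, L n r = 1 := by
      rw [eventually_all_finset]
      intro r hr
      have hpr : p r = 1 := by
        simpa [p] using show r ∈ N from Subgroup.subset_normalClosure hr
      filter_upwards [hL r, hL 1] with n h1 h2
      rw [h1, hpr, ← map_one p, ← h2, map_one]
    filter_upwards [h_all] with n hn
    exact Subgroup.normalClosure_le_normal fun r hr => hn r hr
  let χ (n : ℕ) : Γ →* Equiv.Perm (Fin (k n)) :=
    if h : N ≤ (L n).ker then (QuotientGroup.lift N (L n) h).comp e.symm.toMonoidHom else 1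
  refine ⟨fun n => χ n, fun n g h => map_mul (χ n) g h, fun g => ?_⟩
  obtain ⟨w, hw⟩ := QuotientGroup.mk_surjective (e.symm g)
  have hpw : p w = g := by
    change e (w : FreeGroup (Fin d) ⧸ N) = g
    rw [hw, e.apply_symm_apply]
  filter_upwards [h_rel, hL w] with n h1 h2
  rw [hpw] at h2
  rw [← h2]
  simp only [χ, dif_pos h1]
  change QuotientGroup.lift N (L n) h1 (e.symm g) = L n w
  rw [← hw]
  rfl

/-- Asymptotic closeness is unaffected by changing the second sequence so that it still agrees
eventually with the old one at every element. -/
theorem CloseSeq.congr_right {Γ : Type*} [Group Γ] {k : ℕ → ℕ}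
    {φ ψ χ : ∀ n, Γ → Equiv.Perm (Fin (k n))} (h : CloseSeq k φ ψ)
    (hχ : ∀ g, ∀ᶠ n in atTop, χ n g = ψ n g) : CloseSeq k φ χ := fun g =>
  (h g).congr' <| by
    filter_upwards [hχ g] with n hn
    rw [hn]

/-- A finitely presented locally stable group is stable, and a finitely presented weakly
locally stable group is weakly stable. -/
theorem stable_of_finitelyPresented_locallyStable (Γ : Type) [Group Γ]
    (hfp : IsFinitelyPresented Γ) :
    (IsLocallyStable Γ → IsStable Γ) ∧ (IsWeaklyLocallyStable Γ → IsWeaklyStable Γ) := by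
  refine ⟨fun hs k hk φ hφ => ?_, fun hs k hk φ hφ hsep => ?_⟩
  · obtain ⟨ψ, hψ, hclose⟩ := hs k hk φ hφ
    obtain ⟨χ, hχ, heq⟩ := hψ.exists_isHomSeq_eventually_eq hfp
    exact ⟨χ, hχ, hclose.congr_right heq⟩
  · obtain ⟨ψ, hψ, hclose⟩ := hs k hk φ hφ hsep
    obtain ⟨χ, hχ, heq⟩ := hψ.exists_isHomSeq_eventually_eq hfp
    exact ⟨χ, hχ, hclose.congr_right heq⟩
end

section
/- There exists a finitely generated group which is weakly locally stable but not weakly stable. -/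
open Filter Topology

open scoped Classical

/-- The filter of subsets of `Σ n, Fin (k n)` whose fibres have density tending to one. -/
def densityOne (k : ℕ → ℕ) : Filter (Σ n, Fin (k n)) where
  sets := {S | Tendsto (fun n => ((Finset.univ.filter fun i : Fin (k n) =>
    (⟨n, i⟩ : Σ n, Fin (k n)) ∉ S).card : ℝ) / k n) atTop (𝓝 0)}
  univ_sets := by simp
  sets_of_superset := by
    intro S S' hS hSS'
    refine squeeze_zero (fun n => by positivity) (fun n => ?_) hS
    gcongr
  inter_sets := by
    intro S S' hS hS'
    have h := Tendsto.add hS hS'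
    rw [add_zero] at h
    refine squeeze_zero (fun n => by positivity) (fun n => ?_) h
    rw [← add_div]
    gcongr
    norm_cast
    refine le_trans (Finset.card_le_card ?_) (Finset.card_union_le _ _)
    intro i hi
    simp only [Finset.mem_filter, Finset.mem_univ, true_and, Finset.mem_union,
      Set.mem_inter_iff] at hi ⊢
    tauto

lemma eventually_densityOne_iff {k : ℕ → ℕ} {p : (Σ n, Fin (k n)) → Prop} [DecidablePred p] :
    (∀ᶠ x in densityOne k, p x) ↔ Tendsto (fun n => ((Finset.univ.filter fun i : Fin (k n) =>
      ¬ p ⟨n, i⟩).card : ℝ) / k n) atTop (𝓝 0) := by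
  change {x | p x} ∈ (densityOne k).sets ↔ _
  simp only [densityOne, Set.mem_ofPred_eq]

lemma tendsto_dHam_zero_iff {k : ℕ → ℕ} {a b : ∀ n, Equiv.Perm (Fin (k n))} :
    Tendsto (fun n => dHam (a n) (b n)) atTop (𝓝 0) ↔
      ∀ᶠ p in densityOne k, a p.1 p.2 = b p.1 p.2 := by
  have h : (∀ᶠ p in densityOne k, a p.1 p.2 = b p.1 p.2) ↔
      Tendsto (fun n => ((Finset.univ.filter fun i : Fin (k n) =>
        ¬ (a n i = b n i)).card : ℝ) / k n) atTop (𝓝 0) := eventually_densityOne_iff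
  rw [h]
  rfl

lemma tendsto_dHam_one_iff {k : ℕ → ℕ} (hk : ∀ n, 0 < k n)
    {a b : ∀ n, Equiv.Perm (Fin (k n))} :
    Tendsto (fun n => dHam (a n) (b n)) atTop (𝓝 1) ↔
      ∀ᶠ p in densityOne k, a p.1 p.2 ≠ b p.1 p.2 := by
  have key : ∀ n, ((Finset.univ.filter fun i : Fin (k n) => ¬ (a n i ≠ b n i)).card : ℝ) / k n
      = 1 - dHam (a n) (b n) := by
    intro n
    have h := Finset.card_filter_add_card_filter_not (s := (Finset.univ : Finset (Fin (k n))))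
      (fun i => a n i ≠ b n i)
    rw [Finset.card_univ, Fintype.card_fin] at h
    have hk' : (k n : ℝ) ≠ 0 := by exact_mod_cast (hk n).ne'
    rw [dHam, eq_sub_iff_add_eq, ← add_div, div_eq_one_iff_eq hk']
    exact_mod_cast (add_comm _ _).trans h
  have h1 : (∀ᶠ p in densityOne k, a p.1 p.2 ≠ b p.1 p.2) ↔
      Tendsto (fun n => 1 - dHam (a n) (b n)) atTop (𝓝 0) := by
    rw [← funext key]
    exact eventually_densityOne_iff
  rw [h1]
  constructor
  · intro h
    simpa using h.const_sub 1
  · intro h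
    simpa using h.const_sub 1

lemma eventually_densityOne_perm {k : ℕ → ℕ} {p : (Σ n, Fin (k n)) → Prop}
    (h : ∀ᶠ x in densityOne k, p x) (a : ∀ n, Equiv.Perm (Fin (k n))) :
    ∀ᶠ x in densityOne k, p ⟨x.1, a x.1 x.2⟩ := by
  refine eventually_densityOne_iff.2 ((eventually_densityOne_iff.1 h).congr fun n => ?_)
  congr 2
  refine (Finset.card_bij (fun i _ => a n i) ?_ ?_ ?_).symm
  · simp
  · simp
  · intro i hi
    exact ⟨(a n).symm i, by simpa using hi, by simp⟩

/-- Coordinatewise equality on a set of density tending to one is a congruence on sequences of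
permutations. -/
def densityOneCon (k : ℕ → ℕ) : Con (∀ n, Equiv.Perm (Fin (k n))) where
  r a b := ∀ᶠ p in densityOne k, a p.1 p.2 = b p.1 p.2
  iseqv :=
    { refl := fun a => by simp
      symm := fun h => h.mono fun _ => Eq.symm
      trans := fun h h' => by filter_upwards [h, h'] with p h h' using h.trans h' }
  mul' := by
    intro a b c d h h'
    filter_upwards [h', eventually_densityOne_perm h d] with p h₁ h₂
    simp [h₁, h₂]

lemma densityOneCon_iff {k : ℕ → ℕ} {a b : ∀ n, Equiv.Perm (Fin (k n))} :
    densityOneCon k a b ↔ ∀ᶠ p in densityOne k, a p.1 p.2 = b p.1 p.2 :=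
  Iff.rfl

/-- An almost-homomorphism is a homomorphism modulo density-one equality. -/
def IsAlmostHom.toQuotient {Γ : Type*} [Group Γ] {k : ℕ → ℕ}
    {φ : ∀ n, Γ → Equiv.Perm (Fin (k n))} (h : IsAlmostHom k φ) :
    Γ →* (densityOneCon k).Quotient :=
  MonoidHom.mk' (fun g => (densityOneCon k).mk' fun n => φ n g) fun g g' => by
    rw [← map_mul]
    exact ((densityOneCon k).eq.2 (tendsto_dHam_zero_iff.1 (h g g'))).symm

lemma IsAlmostHom.mul_zpow {Γ : Type*} [Group Γ] {k : ℕ → ℕ}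
    {φ : ∀ n, Γ → Equiv.Perm (Fin (k n))} (hφ : IsAlmostHom k φ) (g h : Γ) (e : ℤ) :
    densityOneCon k (fun n => φ n (g * h ^ e)) ((fun n => φ n g) * (fun n => φ n h) ^ e) := by
  refine (densityOneCon k).eq.1 ?_
  have h₁ : hφ.toQuotient (g * h ^ e) = hφ.toQuotient g * hφ.toQuotient h ^ e := by
    rw [map_mul, map_zpow]
  refine h₁.trans ?_
  change _ = (densityOneCon k).mk' _
  rw [map_mul, map_zpow]
  rfl

section Equivariant

variable {A X : Type*} [Group A]

lemma exists_equiv_orbits_prod (Y : Type*) [MulAction A Y] [IsCancelSMul A Y] :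
    ∃ e : MulAction.orbitRel.Quotient A Y × A ≃ Y, ∀ (a : A) ω b, e (ω, a * b) = a • e (ω, b) := by
  have hbij : Function.Bijective
      fun p : MulAction.orbitRel.Quotient A Y × A => p.2 • Quotient.out p.1 := by
    constructor
    · rintro ⟨ω, a⟩ ⟨ω', a'⟩ h
      have h : a • ω.out = a' • ω'.out := h
      have hω : ω = ω' := by
        rw [← Quotient.out_eq ω, ← Quotient.out_eq ω']
        refine Quotient.sound ?_
        change MulAction.orbitRel A Y _ _
        rw [MulAction.orbitRel_apply]
        exact ⟨a⁻¹ * a', by simp [mul_smul, ← h]⟩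
      subst hω
      rw [IsCancelSMul.right_cancel a a' _ h]
    · intro y
      have h : MulAction.orbitRel A Y y (Quotient.out (Quotient.mk (MulAction.orbitRel A Y) y)) :=
        Setoid.symm' _ (@Quotient.mk_out _ (MulAction.orbitRel A Y) y)
      rw [MulAction.orbitRel_apply] at h
      obtain ⟨a, ha⟩ := h
      exact ⟨(Quotient.mk _ y, a), ha⟩
  exact ⟨Equiv.ofBijective _ hbij, fun a ω b => mul_smul a b _⟩

lemma exists_equivariant_equiv {Y Z : Type*} [Finite Y] [Finite A]
    [MulAction A Y] [MulAction A Z] [IsCancelSMul A Y] [IsCancelSMul A Z]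
    (h : Nat.card Y = Nat.card Z) [Finite Z] : ∃ e : Y ≃ Z, ∀ (a : A) y, e (a • y) = a • e y := by
  obtain ⟨e, he⟩ := exists_equiv_orbits_prod (A := A) Y
  obtain ⟨f, hf⟩ := exists_equiv_orbits_prod (A := A) Z
  have hΩ : Nat.card (MulAction.orbitRel.Quotient A Y) =
      Nat.card (MulAction.orbitRel.Quotient A Z) := by
    rw [← Nat.card_congr e, ← Nat.card_congr f, Nat.card_prod, Nat.card_prod] at h
    exact Nat.eq_of_mul_eq_mul_right Nat.card_pos h
  obtain ⟨o⟩ : Nonempty (MulAction.orbitRel.Quotient A Y ≃ MulAction.orbitRel.Quotient A Z) :=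
    Finite.card_eq.1 hΩ
  refine ⟨e.symm.trans ((o.prodCongr (Equiv.refl A)).trans f), fun a y => ?_⟩
  obtain ⟨⟨ω, b⟩, rfl⟩ := e.surjective y
  simp [← he, hf]

/-- A permutation that is equivariant on most points between two actions of a finite group, both
free on `Y` and trivial off `Y`, can be corrected to an equivariant permutation. -/
lemma exists_equivariant_perm [Finite A] [Finite X] (α β : A →* Equiv.Perm X) (Y : Set X)
    (hα : ∀ a, ∀ x ∈ Y, α a x ∈ Y) (hβ : ∀ a, ∀ x ∈ Y, β a x ∈ Y)
    (hα' : ∀ a, ∀ x ∉ Y, α a x = x) (hβ' : ∀ a, ∀ x ∉ Y, β a x = x)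
    (hα1 : ∀ a, a ≠ 1 → ∀ x ∈ Y, α a x ≠ x) (hβ1 : ∀ a, a ≠ 1 → ∀ x ∈ Y, β a x ≠ x)
    (f : Equiv.Perm X) :
    ∃ T : Equiv.Perm X, (∀ a x, T (α a x) = β a (T x)) ∧
      ∀ x ∈ Y, (∀ a, f (α a x) ∈ Y ∧ f (α a x) = β a (f x)) → T x = f x := by
  set G : Set X := {x | x ∈ Y ∧ ∀ a, f (α a x) ∈ Y ∧ f (α a x) = β a (f x)} with hG
  have hGα : ∀ a, ∀ x ∈ G, α a x ∈ G := by
    rintro a x ⟨hx, h⟩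
    refine ⟨hα a x hx, fun b => ?_⟩
    have h1 : α b (α a x) = α (b * a) x := by simp
    rw [h1]
    refine ⟨(h _).1, ?_⟩
    rw [(h _).2, (h a).2]
    simp
  have hGβ : ∀ a, ∀ x ∈ G, β a (f x) = f (α a x) := fun a x hx => (hx.2 a).2.symm
  have hfG : ∀ x ∈ G, f x ∈ Y := fun x hx => by simpa using (hx.2 1).1
  -- the remaining points on both sides
  have hinv : ∀ (γ : A →* Equiv.Perm X) (Z : Set X), (∀ a, ∀ x ∈ Z, γ a x ∈ Z) →
      ∀ a x, γ a x ∈ Z ↔ x ∈ Z := fun γ Z h a x =>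
    ⟨fun hx => by simpa using h a⁻¹ _ hx, h a x⟩
  have hGβ' : ∀ a, ∀ x ∈ f '' G, β a x ∈ f '' G := by
    rintro a _ ⟨x, hx, rfl⟩
    exact ⟨α a x, hGα a x hx, (hGβ a x hx).symm⟩
  let actOn : ∀ (γ : A →* Equiv.Perm X) (Z : Set X), (∀ a, ∀ x ∈ Z, γ a x ∈ Z) →
      MulAction A Z := fun γ Z h =>
    { smul := fun a x => ⟨γ a x, h a x x.2⟩
      one_smul := fun x => Subtype.ext (by change γ 1 x = x; simp)
      mul_smul := fun a b x => Subtype.ext (by change γ (a * b) x = γ a (γ b x); simp) }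
  have hD : ∀ a, ∀ x ∈ Y \ G, α a x ∈ Y \ G := fun a x hx =>
    ⟨hα a x hx.1, fun h => hx.2 ((hinv α G hGα a x).1 h)⟩
  have hE : ∀ a, ∀ x ∈ Y \ f '' G, β a x ∈ Y \ f '' G := fun a x hx =>
    ⟨hβ a x hx.1, fun h => hx.2 ((hinv β _ hGβ' a x).1 h)⟩
  let _ := actOn α _ hD
  let _ := actOn β _ hE
  have : IsCancelSMul A ↥(Y \ G) := isCancelSMul_iff_eq_one_of_smul_eq.2 fun a x hx => by
    by_contra ha
    exact hα1 a ha x x.2.1 (congrArg Subtype.val hx)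
  have : IsCancelSMul A ↥(Y \ f '' G) := isCancelSMul_iff_eq_one_of_smul_eq.2 fun a x hx => by
    by_contra ha
    exact hβ1 a ha x x.2.1 (congrArg Subtype.val hx)
  have hcard : Nat.card ↥(Y \ G) = Nat.card ↥(Y \ f '' G) := by
    rw [Nat.card_coe_set_eq, Nat.card_coe_set_eq, Set.ncard_sdiff (fun x hx => hx.1),
      Set.ncard_sdiff (Set.image_subset_iff.2 hfG), Set.ncard_image_of_injective _ f.injective]
  obtain ⟨e, he⟩ := exists_equivariant_equiv (A := A) hcard
  let F : X → X := fun x => if hx : x ∈ Y \ G then e ⟨x, hx⟩ else if x ∈ G then f x else x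
  have F1 : ∀ x (hx : x ∈ Y \ G), F x = e ⟨x, hx⟩ := fun x hx => dif_pos hx
  have F2 : ∀ x ∈ G, F x = f x := fun x hx => by
    simp only [F]; rw [dif_neg (fun h => h.2 hx), if_pos hx]
  have F3 : ∀ x ∉ Y, F x = x := fun x hx => by
    simp only [F]; rw [dif_neg (fun h => hx h.1), if_neg (fun h => hx h.1)]
  have cases3 : ∀ x, x ∈ Y \ G ∨ x ∈ G ∨ x ∉ Y := fun x => by
    by_cases h : x ∈ Y <;> by_cases h' : x ∈ G <;> simp [h, h']
  have hF : Function.Injective F := by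
    intro x y hxy
    rcases cases3 x with hx | hx | hx <;> rcases cases3 y with hy | hy | hy
    · rw [F1 x hx, F1 y hy] at hxy
      simpa using e.injective (Subtype.ext hxy)
    · rw [F1 x hx, F2 y hy] at hxy
      exact absurd ⟨y, hy, hxy.symm⟩ (e ⟨x, hx⟩).2.2
    · rw [F1 x hx, F3 y hy] at hxy
      exact absurd (hxy ▸ (e ⟨x, hx⟩).2.1) hy
    · rw [F2 x hx, F1 y hy] at hxy
      exact absurd ⟨x, hx, hxy⟩ (e ⟨y, hy⟩).2.2
    · rw [F2 x hx, F2 y hy] at hxy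
      exact f.injective hxy
    · rw [F2 x hx, F3 y hy] at hxy
      exact absurd (hxy ▸ hfG x hx) hy
    · rw [F3 x hx, F1 y hy] at hxy
      exact absurd (hxy ▸ (e ⟨y, hy⟩).2.1) hx
    · rw [F3 x hx, F2 y hy] at hxy
      exact absurd (hxy ▸ hfG y hy) hx
    · rwa [F3 x hx, F3 y hy] at hxy
  refine ⟨Equiv.ofBijective F (Finite.injective_iff_bijective.1 hF), fun a x => ?_,
    fun x hx h => F2 x ⟨hx, h⟩⟩
  change F (α a x) = β a (F x)
  rcases cases3 x with hx | hx | hx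
  · rw [F1 x hx, F1 _ (hD a x hx)]
    exact congrArg Subtype.val (he a ⟨x, hx⟩)
  · rw [F2 x hx, F2 _ (hGα a x hx), hGβ a x hx]
  · rw [hα' a x hx, F3 x hx, hβ' a x hx]

/-- An almost free almost-action of a finite group agrees on most points with an action that is
free on `Y` and trivial off `Y`. -/
lemma exists_free_action (φ : A → Equiv.Perm X) :
    ∃ (Y : Set X) (ρ : A →* Equiv.Perm X), (∀ a, ∀ x ∈ Y, ρ a x ∈ Y) ∧
      (∀ a, ∀ x ∉ Y, ρ a x = x) ∧ (∀ a, a ≠ 1 → ∀ x ∈ Y, ρ a x ≠ x) ∧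
      (∀ a, ∀ x ∈ Y, ρ a x = φ a x) ∧
      ∀ x, (∀ c a b, φ a (φ b (φ c x)) = φ (a * b) (φ c x) ∧
        (a ≠ 1 → φ a (φ c x) ≠ φ c x)) → (∀ a b, φ a (φ b x) = φ (a * b) x) →
        (∀ a, a ≠ 1 → φ a x ≠ x) → x ∈ Y := by
  set Y : Set X := {x | (∀ a b, φ a (φ b x) = φ (a * b) x) ∧ (∀ a, a ≠ 1 → φ a x ≠ x) ∧
    ∀ c a b, φ a (φ b (φ c x)) = φ (a * b) (φ c x) ∧ (a ≠ 1 → φ a (φ c x) ≠ φ c x)} with hY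
  have hmem : ∀ a, ∀ x ∈ Y, φ a x ∈ Y := by
    rintro a x ⟨h1, h2, h3⟩
    refine ⟨fun b c => (h3 a b c).1, fun b => (h3 a b 1).2, fun c b d => ?_⟩
    rw [h1 c a]
    exact h3 _ _ _
  have hone : ∀ x ∈ Y, φ 1 x = x := fun x hx => (φ 1).injective (by simpa using hx.1 1 1)
  have hinv : ∀ a, ∀ x ∈ Y, φ a (φ a⁻¹ x) = x := fun a x hx => by
    rw [hx.1, mul_inv_cancel, hone x hx]
  let F : A → X → X := fun a x => if x ∈ Y then φ a x else x
  have F1 : ∀ a, ∀ x ∈ Y, F a x = φ a x := fun a x hx => if_pos hx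
  have F2 : ∀ a, ∀ x ∉ Y, F a x = x := fun a x hx => if_neg hx
  let _ : MulAction A X :=
    { smul := F
      one_smul := fun x => by
        change F 1 x = x
        by_cases hx : x ∈ Y
        · rw [F1 _ x hx, hone x hx]
        · exact F2 _ x hx
      mul_smul := fun a b x => by
        change F (a * b) x = F a (F b x)
        by_cases hx : x ∈ Y
        · rw [F1 _ x hx, F1 _ x hx, F1 _ _ (hmem b x hx), hx.1]
        · rw [F2 _ x hx, F2 _ x hx, F2 _ x hx] }
  refine ⟨Y, MulAction.toPermHom A X, fun a x hx => ?_, fun a x hx => F2 a x hx,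
    fun a ha x hx => ?_, fun a x hx => F1 a x hx, fun x h h' h'' => ⟨h', h'', h⟩⟩
  · change F a x ∈ Y
    rw [F1 a x hx]
    exact hmem a x hx
  · change F a x ≠ x
    rw [F1 a x hx]
    exact hx.2.1 a ha

end Equivariant

lemma exists_tendsto_atTop_diagonal {P : ℕ → ℕ → Prop} (h : ∀ m, ∀ᶠ n in atTop, P m n) :
    ∃ f : ℕ → ℕ, Tendsto f atTop atTop ∧ ∀ᶠ n in atTop, P (f n) n := by
  refine ⟨fun n => Nat.findGreatest (fun m => P m n) n, tendsto_atTop.2 fun m => ?_, ?_⟩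
  · filter_upwards [h m, eventually_ge_atTop m] with n hn hmn
    exact Nat.le_findGreatest hmn hn
  · filter_upwards [h 0] with n hn
    exact Nat.findGreatest_spec (P := fun m => P m n) (Nat.zero_le n) hn

/-- A group `Γ` written as the extension of `ℤ`, generated by the image of `shift`, by an increasing
union of finite subgroups, each conjugated by `shift` and `shift⁻¹` into the next one. -/
structure ShiftFiltration (Γ : Type*) [Group Γ] where
  shift : Γ
  deg : Γ →* Multiplicative ℤ
  level : ℕ → Subgroup Γ
  deg_shift : deg shift = Multiplicative.ofAdd 1
  finite_level : ∀ m, Finite (level m)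
  mono : Monotone level
  deg_eq_one_iff : ∀ g, deg g = 1 ↔ ∃ m, g ∈ level m
  conj_mem : ∀ {m g}, g ∈ level m → shift * g * shift⁻¹ ∈ level (m + 1)
  conj_inv_mem : ∀ {m g}, g ∈ level m → shift⁻¹ * g * shift ∈ level (m + 1)

namespace ShiftFiltration

variable {Γ : Type*} [Group Γ] (S : ShiftFiltration Γ)

/-- The exponent of `shift` in `g`. -/
def exponent (g : Γ) : ℤ := (S.deg g).toAdd

/-- The component of `g` in the kernel of `deg`. -/
def base (g : Γ) : Γ := g * (S.shift ^ S.exponent g)⁻¹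

lemma base_mul_shift (g : Γ) : S.base g * S.shift ^ S.exponent g = g := by
  simp [base]

lemma exponent_mul (g h : Γ) : S.exponent (g * h) = S.exponent g + S.exponent h := by
  simp [exponent]

lemma exists_base_mem (g : Γ) : ∃ m, S.base g ∈ S.level m := by
  rw [← S.deg_eq_one_iff, base, map_mul, map_inv, map_zpow, S.deg_shift, exponent,
    mul_inv_eq_one]
  apply Multiplicative.toAdd.injective
  simp

lemma base_mul (g h : Γ) : S.base (g * h) =
    S.base g * (S.shift ^ S.exponent g * S.base h * (S.shift ^ S.exponent g)⁻¹) := by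
  simp only [base, exponent_mul, zpow_add]
  group

lemma conj_pow_mem {m : ℕ} {g : Γ} (hg : g ∈ S.level m) (j : ℕ) :
    S.shift ^ j * g * (S.shift ^ j)⁻¹ ∈ S.level (m + j) := by
  induction j with
  | zero => simpa using hg
  | succ j ih =>
    have h := S.conj_mem ih
    rw [pow_succ', ← add_assoc]
    convert h using 1
    group

lemma conj_inv_pow_mem {m : ℕ} {g : Γ} (hg : g ∈ S.level m) (j : ℕ) :
    (S.shift ^ j)⁻¹ * g * S.shift ^ j ∈ S.level (m + j) := by
  induction j with
  | zero => simpa using hg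
  | succ j ih =>
    have h := S.conj_inv_mem ih
    rw [pow_succ, ← add_assoc]
    convert h using 1
    group

/-- A pair `(R, T)` satisfying, inside `P`, the relations between `shift` and the elements of
`level m` that only involve `level m`. -/
structure LocalRep (m : ℕ) {P : Type*} [Group P] (R : Γ → P) (T : P) : Prop where
  mul : ∀ g ∈ S.level m, ∀ h ∈ S.level m, R (g * h) = R g * R h
  conj : ∀ g ∈ S.level m, S.shift * g * S.shift⁻¹ ∈ S.level m →
    T * R g * T⁻¹ = R (S.shift * g * S.shift⁻¹)

variable {S}

namespace LocalRep

variable {m : ℕ} {P : Type*} [Group P] {R : Γ → P} {T : P}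

lemma conj_pow (hR : S.LocalRep m R T) {a : ℕ} {g : Γ} (hg : g ∈ S.level a) (j : ℕ)
    (h : a + j ≤ m) : T ^ j * R g * (T ^ j)⁻¹ = R (S.shift ^ j * g * (S.shift ^ j)⁻¹) := by
  induction j with
  | zero => simp
  | succ j ih =>
    have e : S.shift ^ (j + 1) * g * (S.shift ^ (j + 1))⁻¹ =
        S.shift * (S.shift ^ j * g * (S.shift ^ j)⁻¹) * S.shift⁻¹ := by
      rw [pow_succ']; group
    have h₁ := S.conj_pow_mem hg j
    rw [e, ← hR.conj _ (S.mono (by omega) h₁) (S.mono (by omega) (S.conj_mem h₁)),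
      ← ih (by omega), pow_succ']
    group

lemma conj_inv_pow (hR : S.LocalRep m R T) {a : ℕ} {g : Γ} (hg : g ∈ S.level a) (j : ℕ)
    (h : a + j ≤ m) : (T ^ j)⁻¹ * R g * T ^ j = R ((S.shift ^ j)⁻¹ * g * S.shift ^ j) := by
  induction j with
  | zero => simp
  | succ j ih =>
    have e : (S.shift ^ (j + 1))⁻¹ * g * S.shift ^ (j + 1) =
        S.shift⁻¹ * ((S.shift ^ j)⁻¹ * g * S.shift ^ j) * S.shift := by
      rw [pow_succ]; group
    have h₁ := S.conj_inv_pow_mem hg j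
    have h₂ := S.conj_inv_mem h₁
    have h₃ := hR.conj _ (S.mono (by omega) h₂) (by
      convert S.mono (show a + j ≤ m by omega) h₁ using 1
      group)
    have e' : S.shift * (S.shift⁻¹ * ((S.shift ^ j)⁻¹ * g * S.shift ^ j) * S.shift) * S.shift⁻¹ =
        (S.shift ^ j)⁻¹ * g * S.shift ^ j := by group
    rw [e', ← ih (by omega)] at h₃
    rw [e, pow_succ]
    have h₄ := congrArg (fun x => T⁻¹ * x * T) h₃
    simp only [mul_assoc, inv_mul_cancel_left, inv_mul_cancel, mul_one] at h₄
    simp only [mul_assoc, h₄, mul_inv_rev]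

lemma conj_zpow (hR : S.LocalRep m R T) {a : ℕ} {g : Γ} (hg : g ∈ S.level a) (j : ℤ)
    (h : a + j.natAbs ≤ m) :
    T ^ j * R g * (T ^ j)⁻¹ = R (S.shift ^ j * g * (S.shift ^ j)⁻¹) := by
  obtain ⟨j, rfl | rfl⟩ := j.eq_nat_or_neg
  · simpa using hR.conj_pow hg j (by simpa using h)
  · simpa using hR.conj_inv_pow hg j (by simpa using h)

end LocalRep

lemma conj_zpow_mem {m : ℕ} {g : Γ} (hg : g ∈ S.level m) (j : ℤ) :
    S.shift ^ j * g * (S.shift ^ j)⁻¹ ∈ S.level (m + j.natAbs) := by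
  obtain ⟨j, rfl | rfl⟩ := j.eq_nat_or_neg
  · simpa using S.conj_pow_mem hg j
  · simpa using S.conj_inv_pow_mem hg j

variable (S)

/-- The map `Γ → P` determined by its values `R` on the kernel of `deg` and `T` at `shift`. -/
def extend {P : Type*} [Group P] (R : Γ → P) (T : P) (g : Γ) : P :=
  R (S.base g) * T ^ S.exponent g

lemma exists_extend_mul (g h : Γ) : ∃ m₀, ∀ m, m₀ ≤ m → ∀ (P : Type) [Group P] (R : Γ → P) (T : P),
    S.LocalRep m R T → S.extend R T (g * h) = S.extend R T g * S.extend R T h := by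
  obtain ⟨a, ha⟩ := S.exists_base_mem g
  obtain ⟨b, hb⟩ := S.exists_base_mem h
  refine ⟨a + b + (S.exponent g).natAbs, fun m hm P _ R T hR => ?_⟩
  have h₁ := conj_zpow_mem hb (S.exponent g)
  rw [extend, base_mul, hR.mul _ (S.mono (by omega) ha) _ (S.mono (by omega) h₁),
    ← hR.conj_zpow hb _ (by omega), exponent_mul, zpow_add, extend, extend]
  group

lemma isPartialHom_extend {k : ℕ → ℕ} {R : ∀ n, Γ → Equiv.Perm (Fin (k n))}
    {T : ∀ n, Equiv.Perm (Fin (k n))} {f : ℕ → ℕ} (hf : Tendsto f atTop atTop)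
    (hR : ∀ n, S.LocalRep (f n) (R n) (T n)) :
    IsPartialHom k fun n => S.extend (R n) (T n) := by
  intro g h
  obtain ⟨m₀, hm₀⟩ := S.exists_extend_mul g h
  filter_upwards [hf.eventually_ge_atTop m₀] with n hn
  exact hm₀ _ hn _ _ _ (hR n)

lemma exists_localRep {k : ℕ → ℕ} {φ : ∀ n, Γ → Equiv.Perm (Fin (k n))} (hφ : IsAlmostHom k φ)
    (hφ' : ∀ g, g ≠ 1 → ∀ᶠ p in densityOne k, φ p.1 g p.2 ≠ p.2) (m : ℕ) :
    ∃ (R : ∀ n, Γ → Equiv.Perm (Fin (k n))) (T : ∀ n, Equiv.Perm (Fin (k n))),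
      (∀ n, S.LocalRep m (R n) (T n)) ∧
      (∀ g ∈ S.level m, ∀ᶠ p in densityOne k, R p.1 g p.2 = φ p.1 g p.2) ∧
      ∀ᶠ p in densityOne k, T p.1 p.2 = φ p.1 S.shift p.2 := by
  have := S.finite_level m
  set F := S.level m with hF
  set t := S.shift with ht
  have hmul : ∀ a b : Γ, ∀ᶠ p in densityOne k, φ p.1 a (φ p.1 b p.2) = φ p.1 (a * b) p.2 :=
    fun a b => (tendsto_dHam_zero_iff (a := fun n => φ n a * φ n b)
      (b := fun n => φ n (a * b))).1 (hφ a b)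
  choose Y ρ hρY hρ hfree hρφ hYmem using
    fun n => exists_free_action (fun a : F => φ n a)
  have hY : ∀ᶠ p in densityOne k, p.2 ∈ Y p.1 := by
    have hfix : ∀ᶠ p in densityOne k, ∀ a : F, a ≠ 1 → φ p.1 a p.2 ≠ p.2 :=
      eventually_all.2 fun a => eventually_imp_distrib_left.2 fun ha => hφ' a (by simpa using ha)
    have hm : ∀ᶠ p in densityOne k, ∀ a b : F, φ p.1 a (φ p.1 b p.2) = φ p.1 (a * b : F) p.2 :=
      eventually_all.2 fun a => eventually_all.2 fun b => by simpa using hmul a b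
    have hm' : ∀ᶠ p in densityOne k, ∀ c a b : F,
        φ p.1 a (φ p.1 b (φ p.1 c p.2)) = φ p.1 (a * b : F) (φ p.1 c p.2) :=
      eventually_all.2 fun c => eventually_densityOne_perm hm fun n => φ n c
    have hfix' : ∀ᶠ p in densityOne k, ∀ c a : F,
        a ≠ 1 → φ p.1 a (φ p.1 c p.2) ≠ φ p.1 c p.2 :=
      eventually_all.2 fun c => eventually_densityOne_perm hfix fun n => φ n c
    filter_upwards [hfix, hm, hm', hfix'] with p h₁ h₂ h₃ h₄
    exact hYmem p.1 p.2 (fun c a b => ⟨h₃ c a b, h₄ c a⟩) h₂ h₁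
  set A : Subgroup Γ := F ⊓ F.comap (MulAut.conj t).toMonoidHom with hA
  have hAfin : Finite A :=
    Finite.of_injective _ (Subgroup.inclusion_injective (inf_le_left : A ≤ F))
  let i : A →* F := Subgroup.inclusion inf_le_left
  let j : A →* F := ((MulAut.conj t).toMonoidHom.comp A.subtype).codRestrict F fun a => a.2.2
  have hi : ∀ a, a ≠ 1 → i a ≠ 1 := fun a ha h => ha
    (Subtype.ext (congrArg Subtype.val h : (a : Γ) = 1))
  have hj : ∀ a, a ≠ 1 → j a ≠ 1 := fun a ha h => ha (by
    have h' : t * a * t⁻¹ = 1 := congrArg Subtype.val h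
    apply Subtype.ext
    simpa using h')
  choose T hT hTf using fun n => exists_equivariant_perm ((ρ n).comp i) ((ρ n).comp j) (Y n)
    (fun a => hρY n (i a)) (fun a => hρY n (j a)) (fun a => hρ n (i a)) (fun a => hρ n (j a))
    (fun a ha => hfree n _ (hi a ha)) (fun a ha => hfree n _ (hj a ha)) (φ n t)
  refine ⟨fun n g => if h : g ∈ F then ρ n ⟨g, h⟩ else 1, T, fun n => ⟨?_, ?_⟩, ?_, ?_⟩
  · intro g hg h hh
    beta_reduce
    rw [dif_pos (mul_mem hg hh), dif_pos hg, dif_pos hh, ← map_mul]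
    rfl
  · intro g hg hg'
    beta_reduce
    rw [dif_pos hg, dif_pos hg', mul_inv_eq_iff_eq_mul]
    exact Equiv.ext fun x => hT n ⟨g, hg, hg'⟩ x
  · intro g hg
    filter_upwards [hY] with p hp
    rw [dif_pos hg, hρφ _ _ _ hp]
  · have hYt : ∀ᶠ p in densityOne k, φ p.1 t p.2 ∈ Y p.1 :=
      eventually_densityOne_perm hY fun n => φ n t
    have hYa : ∀ᶠ p in densityOne k, ∀ a : A, φ p.1 t (φ p.1 a p.2) ∈ Y p.1 :=
      eventually_all.2 fun a => eventually_densityOne_perm hYt fun n => φ n a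
    have hta : ∀ᶠ p in densityOne k, ∀ a : A,
        φ p.1 t (φ p.1 a p.2) = φ p.1 (t * a * t⁻¹) (φ p.1 t p.2) :=
      eventually_all.2 fun a => by
        filter_upwards [hmul t a, hmul (t * a * t⁻¹) t] with p h₁ h₂
        rw [h₁, h₂, inv_mul_cancel_right]
    filter_upwards [hY, hYt, hYa, hta] with p h₁ h₂ h₃ h₄
    refine hTf p.1 p.2 h₁ fun a => ?_
    have e₁ : (ρ p.1).comp i a p.2 = φ p.1 a p.2 := hρφ p.1 (i a) p.2 h₁
    have e₂ : (ρ p.1).comp j a (φ p.1 t p.2) = φ p.1 (t * a * t⁻¹) (φ p.1 t p.2) :=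
      hρφ p.1 (j a) _ h₂
    rw [e₁, e₂]
    exact ⟨h₃ a, h₄ a⟩

theorem isWeaklyLocallyStable (S : ShiftFiltration Γ) : IsWeaklyLocallyStable Γ := by
  intro k hk φ hφ hsep
  have hsep' : ∀ g, g ≠ 1 → ∀ᶠ p in densityOne k, φ p.1 g p.2 ≠ p.2 := fun g hg =>
    (tendsto_dHam_one_iff hk (a := fun n => φ n g) (b := fun _ => 1)).1 (hsep g hg)
  choose R T hRT hR hT using S.exists_localRep hφ hsep'
  have hdiag : ∀ m, ∀ᶠ n in atTop, (∀ g : S.level m, dHam (R m n g) (φ n g) < 1 / ((m : ℝ) + 1)) ∧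
      dHam (T m n) (φ n S.shift) < 1 / ((m : ℝ) + 1) := by
    intro m
    have := S.finite_level m
    have hpos : (0 : ℝ) < 1 / ((m : ℝ) + 1) := by positivity
    refine (eventually_all.2 fun g => ?_).and ?_
    · exact ((tendsto_dHam_zero_iff (a := fun n => R m n g) (b := fun n => φ n g)).2
        (hR m g g.2)).eventually_lt_const hpos
    · exact ((tendsto_dHam_zero_iff (a := fun n => T m n) (b := fun n => φ n S.shift)).2
        (hT m)).eventually_lt_const hpos
  obtain ⟨f, hf, hfP⟩ := exists_tendsto_atTop_diagonal hdiag
  have hlim : Tendsto (fun n => 1 / ((f n : ℝ) + 1)) atTop (𝓝 0) :=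
    tendsto_one_div_add_atTop_nhds_zero_nat.comp hf
  have dHam_nonneg : ∀ {l : ℕ} (a b : Equiv.Perm (Fin l)), 0 ≤ dHam a b := fun a b => by
    unfold dHam; positivity
  have hR' : ∀ m, ∀ g ∈ S.level m,
      densityOneCon k (fun n => R (f n) n g) (fun n => φ n g) := by
    intro m g hg
    refine (tendsto_dHam_zero_iff (a := fun n => R (f n) n g) (b := fun n => φ n g)).1
      (squeeze_zero' (Eventually.of_forall fun n => dHam_nonneg _ _) ?_ hlim)
    filter_upwards [hfP, hf.eventually_ge_atTop m] with n hn hm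
    exact (hn.1 ⟨g, S.mono hm hg⟩).le
  have hT' : densityOneCon k (fun n => T (f n) n) (fun n => φ n S.shift) := by
    refine (tendsto_dHam_zero_iff (a := fun n => T (f n) n) (b := fun n => φ n S.shift)).1
      (squeeze_zero' (Eventually.of_forall fun n => dHam_nonneg _ _) ?_ hlim)
    filter_upwards [hfP] with n hn
    exact hn.2.le
  refine ⟨fun n => S.extend (R (f n) n) (T (f n) n), S.isPartialHom_extend hf fun n => hRT _ _,
    fun g => (tendsto_dHam_zero_iff (a := fun n => φ n g)
      (b := fun n => S.extend (R (f n) n) (T (f n) n) g)).2 ?_⟩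
  obtain ⟨m, hm⟩ := S.exists_base_mem g
  have e₁ : densityOneCon k (fun n => φ n g)
      ((fun n => φ n (S.base g)) * (fun n => φ n S.shift) ^ S.exponent g) := by
    have e := hφ.mul_zpow (S.base g) S.shift (S.exponent g)
    rwa [S.base_mul_shift] at e
  have e₂ : densityOneCon k
      ((fun n => R (f n) n (S.base g)) * (fun n => T (f n) n) ^ S.exponent g)
      ((fun n => φ n (S.base g)) * (fun n => φ n S.shift) ^ S.exponent g) :=
    (densityOneCon k).mul (hR' m _ hm) ((densityOneCon k).zpow (S.exponent g) hT')
  filter_upwards [densityOneCon_iff.1 ((densityOneCon k).trans e₁ ((densityOneCon k).symm e₂))]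
    with p hp
  rw [hp]
  rfl

end ShiftFiltration

/-- A group that is locally embeddable into finite groups is sofic. -/
lemma isSofic_of_eventually_mul {Γ : Type*} [Group Γ] (P : ℕ → Type) [∀ n, Group (P n)]
    [∀ n, Finite (P n)] (θ : ∀ n, Γ → P n)
    (hmul : ∀ g h, ∀ᶠ n in atTop, θ n (g * h) = θ n g * θ n h)
    (hne : ∀ g, g ≠ 1 → ∀ᶠ n in atTop, θ n g ≠ 1) : IsSofic Γ := by
  have hk : ∀ n, 0 < Nat.card (P n) := fun n => Nat.card_pos
  refine ⟨fun n => Nat.card (P n), hk, fun n g =>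
    (Finite.equivFin (P n)).permCongr (MulAction.toPerm (θ n g)), fun g h => ?_, fun g hg => ?_⟩
  · refine Tendsto.congr' ?_ tendsto_const_nhds
    filter_upwards [hmul g h] with n hn
    have : ∀ i, ¬ (((Finite.equivFin (P n)).permCongr (MulAction.toPerm (θ n g)) *
        (Finite.equivFin (P n)).permCongr (MulAction.toPerm (θ n h))) i ≠
        (Finite.equivFin (P n)).permCongr (MulAction.toPerm (θ n (g * h))) i) := by
      simp [hn, mul_assoc]
    simp only [dHam]
    rw [Finset.filter_false_of_mem fun i _ => this i]
    simp
  · refine Tendsto.congr' ?_ tendsto_const_nhds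
    filter_upwards [hne g hg] with n hn
    have : ∀ i, (Finite.equivFin (P n)).permCongr (MulAction.toPerm (θ n g)) i ≠
        (1 : Equiv.Perm (Fin (Nat.card (P n)))) i := by
      intro i h
      refine hn ?_
      simpa [Equiv.permCongr_apply, ← Equiv.eq_symm_apply] using h
    have hk' : (Nat.card (P n) : ℝ) ≠ 0 := by exact_mod_cast (hk n).ne'
    simp only [dHam]
    rw [Finset.filter_true_of_mem fun i _ => this i, Finset.card_univ, Fintype.card_fin,
      div_self hk']

/-- A weakly stable sofic group is residually finite. -/
lemma not_isWeaklyStable_of_isSofic {Γ : Type*} [Group Γ] (hΓ : IsSofic Γ) {z : Γ} (hz : z ≠ 1)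
    (h : ∀ (P : Type) [Group P] [Finite P] (f : Γ →* P), f z = 1) : ¬ IsWeaklyStable Γ := by
  rintro hst
  obtain ⟨k, hk, φ, hφ, hsep⟩ := hΓ
  obtain ⟨ψ, hψ, hclose⟩ := hst k hk φ hφ hsep
  have h₁ : ∀ n, ψ n z = 1 := fun n => h _ (MonoidHom.mk' (ψ n) (hψ n))
  have h₂ := hclose z
  simp only [h₁] at h₂
  exact zero_ne_one (tendsto_nhds_unique h₂ (hsep z hz))

/-- The translation `x ↦ x + 1` of `ℤ`. -/
def intShift : Equiv.Perm ℤ := Equiv.addRight 1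

lemma intShift_zpow_apply (j x : ℤ) : (intShift ^ j) x = x + j := by
  simp [intShift]

/-- The group of permutations of `ℤ` generated by the translation by one and a transposition of
neighbours. -/
abbrev shiftSwapGroup : Subgroup (Equiv.Perm ℤ) :=
  Subgroup.closure {intShift, Equiv.swap 0 1}

namespace shiftSwapGroup

instance : Group.FG shiftSwapGroup :=
  (Group.fg_iff_subgroup_fg _).2 ⟨{intShift, Equiv.swap 0 1}, by simp⟩

lemma exists_drift (g : shiftSwapGroup) :
    ∃ j : ℤ, ∀ᶠ x in cofinite, (g : Equiv.Perm ℤ) x = x + j := by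
  obtain ⟨g, hg⟩ := g
  change ∃ j : ℤ, ∀ᶠ x in cofinite, g x = x + j
  induction hg using Subgroup.closure_induction with
  | mem g hg =>
    rcases hg with rfl | rfl
    · exact ⟨1, by simp [intShift]⟩
    · refine ⟨0, ?_⟩
      have : ∀ᶠ x : ℤ in cofinite, x ∉ ({0, 1} : Set ℤ) :=
        (Set.toFinite _).eventually_cofinite_notMem
      filter_upwards [this] with x hx
      simp only [Set.mem_insert_iff, Set.mem_singleton_iff, not_or] at hx
      rw [Equiv.swap_apply_of_ne_of_ne hx.1 hx.2, add_zero]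
  | one => exact ⟨0, by simp⟩
  | mul g h _ _ hg hh =>
    obtain ⟨i, hi⟩ := hg
    obtain ⟨j, hj⟩ := hh
    refine ⟨j + i, ?_⟩
    filter_upwards [hj, h.injective.tendsto_cofinite.eventually hi] with x h₁ h₂
    rw [Equiv.Perm.mul_apply, h₂, h₁, add_assoc]
  | inv g _ hg =>
    obtain ⟨i, hi⟩ := hg
    refine ⟨-i, ?_⟩
    filter_upwards [g⁻¹.injective.tendsto_cofinite.eventually hi] with x h
    change g (g.symm x) = g.symm x + i at h
    rw [Equiv.apply_symm_apply] at h
    change g.symm x = x + -i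
    omega

/-- The amount by which an element translates all but finitely many integers. -/
noncomputable def drift (g : shiftSwapGroup) : ℤ := (exists_drift g).choose

lemma eventually_drift (g : shiftSwapGroup) :
    ∀ᶠ x in cofinite, (g : Equiv.Perm ℤ) x = x + drift g :=
  (exists_drift g).choose_spec

lemma drift_eq {g : shiftSwapGroup} {j : ℤ}
    (h : ∀ᶠ x in cofinite, (g : Equiv.Perm ℤ) x = x + j) : drift g = j := by
  obtain ⟨x, h₁, h₂⟩ := ((eventually_drift g).and h).exists
  omega

lemma drift_mul (g h : shiftSwapGroup) : drift (g * h) = drift g + drift h := by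
  apply drift_eq
  filter_upwards [eventually_drift h, (h : Equiv.Perm ℤ).injective.tendsto_cofinite.eventually
    (eventually_drift g)] with x h₁ h₂
  rw [Subgroup.coe_mul, Equiv.Perm.mul_apply, h₂, h₁]
  ring

/-- The translation by one. -/
def shift : shiftSwapGroup := ⟨intShift, Subgroup.subset_closure (by simp)⟩

/-- The transposition of `0` and `1`. -/
def swap : shiftSwapGroup := ⟨Equiv.swap 0 1, Subgroup.subset_closure (by simp)⟩

/-- The subgroup of elements supported in `[-m, m]`. -/
def level (m : ℕ) : Subgroup shiftSwapGroup where
  carrier := {g | ∀ x : ℤ, m < x.natAbs → (g : Equiv.Perm ℤ) x = x}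
  one_mem' := by simp
  mul_mem' := by
    intro g h hg hh x hx
    rw [Subgroup.coe_mul, Equiv.Perm.mul_apply, hh x hx, hg x hx]
  inv_mem' := by
    intro g hg x hx
    rw [Subgroup.coe_inv, Equiv.Perm.inv_eq_iff_eq, hg x hx]

lemma mem_level {m : ℕ} {g : shiftSwapGroup} :
    g ∈ level m ↔ ∀ x : ℤ, m < x.natAbs → (g : Equiv.Perm ℤ) x = x :=
  Iff.rfl

lemma natAbs_apply_le {m : ℕ} {g : shiftSwapGroup} (hg : g ∈ level m) {x : ℤ}
    (hx : x.natAbs ≤ m) : ((g : Equiv.Perm ℤ) x).natAbs ≤ m := by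
  by_contra! h
  rw [(g : Equiv.Perm ℤ).injective (mem_level.1 hg _ h)] at h
  omega

lemma shift_conj_apply (g : shiftSwapGroup) (x : ℤ) :
    ((shift * g * shift⁻¹ : shiftSwapGroup) : Equiv.Perm ℤ) x =
      (g : Equiv.Perm ℤ) (x - 1) + 1 := rfl

lemma shift_conj_inv_apply (g : shiftSwapGroup) (x : ℤ) :
    ((shift⁻¹ * g * shift : shiftSwapGroup) : Equiv.Perm ℤ) x =
      (g : Equiv.Perm ℤ) (x + 1) - 1 := rfl

/-- The filtration of `shiftSwapGroup` by supports. -/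
noncomputable def filtration : ShiftFiltration shiftSwapGroup where
  shift := shift
  deg := MonoidHom.mk' (fun g => Multiplicative.ofAdd (drift g)) fun g h => by
    rw [drift_mul, ofAdd_add]
  level := level
  deg_shift := congrArg Multiplicative.ofAdd
    (drift_eq (Eventually.of_forall fun x => by simp [shift, intShift]))
  finite_level m := by
    refine Finite.of_injective (β := Set.Icc (-m : ℤ) m → Set.Icc (-m : ℤ) m)
      (fun g x => ⟨(g : Equiv.Perm ℤ) x, ?_⟩) ?_
    · have h := natAbs_apply_le g.2 (x := x) (by have := x.2.1; have := x.2.2; omega)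
      constructor <;> omega
    · intro g h hgh
      apply Subtype.ext
      apply Subtype.ext
      ext x
      by_cases hx : m < x.natAbs
      · rw [mem_level.1 g.2 x hx, mem_level.1 h.2 x hx]
      · exact congrArg Subtype.val (congrFun hgh ⟨x, by constructor <;> omega⟩)
  mono := fun m m' hm g hg x hx => hg x (by omega)
  deg_eq_one_iff g := by
    change drift g = 0 ↔ _
    constructor
    · intro h
      have hfin := eventually_drift g
      simp only [h, add_zero] at hfin
      obtain ⟨m, hm⟩ := ((Filter.eventually_cofinite.1 hfin).image Int.natAbs).bddAbove
      refine ⟨m, fun x hx => ?_⟩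
      by_contra hne
      exact absurd (hm ⟨x, hne, rfl⟩) (by omega)
    · rintro ⟨m, hm⟩
      apply drift_eq
      have : ∀ᶠ x : ℤ in cofinite, x ∉ Set.Icc (-m : ℤ) m :=
        (Set.finite_Icc _ _).eventually_cofinite_notMem
      filter_upwards [this] with x hx
      rw [add_zero]
      refine hm x ?_
      rw [Set.mem_Icc] at hx
      omega
  conj_mem := by
    intro m g hg x hx
    rw [shift_conj_apply, mem_level.1 hg _ (by omega), sub_add_cancel]
  conj_inv_mem := by
    intro m g hg x hx
    rw [shift_conj_inv_apply, mem_level.1 hg _ (by omega), add_sub_cancel_right]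

lemma swap_commutator_ne_one :
    swap * (shift * swap * shift⁻¹) * swap⁻¹ * (shift * swap * shift⁻¹)⁻¹ ≠ 1 := by
  intro h
  rw [mul_inv_eq_one, mul_inv_eq_iff_eq_mul] at h
  have h' := congrArg (fun g : shiftSwapGroup => (g : Equiv.Perm ℤ) 0) h
  simp only [Subgroup.coe_mul, Equiv.Perm.mul_apply] at h'
  revert h'
  decide

lemma commute_swap (j : ℕ) (hj : 3 ≤ j) :
    Commute (shift ^ j * swap * (shift ^ j)⁻¹) (shift * swap * shift⁻¹) := by
  have h : Equiv.Perm.Disjoint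
      ((shift ^ j * swap * (shift ^ j)⁻¹ : shiftSwapGroup) : Equiv.Perm ℤ)
      ((shift * swap * shift⁻¹ : shiftSwapGroup) : Equiv.Perm ℤ) := by
    intro x
    have h₁ : ((shift ^ j * swap * (shift ^ j)⁻¹ : shiftSwapGroup) : Equiv.Perm ℤ) x =
        Equiv.swap 0 1 (x - j) + j := by
      change (intShift ^ j) (Equiv.swap 0 1 ((intShift ^ j)⁻¹ x)) = _
      rw [← zpow_natCast, ← zpow_neg, intShift_zpow_apply, intShift_zpow_apply, ← sub_eq_add_neg]
    have h₂ : ((shift * swap * shift⁻¹ : shiftSwapGroup) : Equiv.Perm ℤ) x =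
        Equiv.swap 0 1 (x - 1) + 1 := rfl
    rw [h₁, h₂, Equiv.swap_apply_def, Equiv.swap_apply_def]
    split_ifs <;> omega
  exact Subtype.ext h.commute

lemma map_swap_commutator_eq_one (P : Type) [Group P] [Finite P] (f : shiftSwapGroup →* P) :
    f (swap * (shift * swap * shift⁻¹) * swap⁻¹ * (shift * swap * shift⁻¹)⁻¹) = 1 := by
  have hr : 0 < orderOf (f shift) := orderOf_pos _
  have h := (commute_swap (3 * orderOf (f shift)) (by omega)).map f
  have e : f (shift ^ (3 * orderOf (f shift)) * swap * (shift ^ (3 * orderOf (f shift)))⁻¹) =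
      f swap := by
    rw [map_mul, map_mul, map_inv, map_pow, mul_comm 3, pow_mul, pow_orderOf_eq_one]
    simp
  rw [e] at h
  rw [map_mul, map_mul, map_mul, map_inv, map_inv, h.eq]
  group

lemma valMinAbs_intCast {m : ℕ} {y : ℤ} (hy : y.natAbs ≤ m) :
    (y : ZMod (2 * m + 1)).valMinAbs = y :=
  (ZMod.valMinAbs_spec _ _).2 ⟨rfl, by push_cast; constructor <;> omega⟩

lemma exists_intCast_eq {m : ℕ} (x : ZMod (2 * m + 1)) :
    ∃ y : ℤ, y.natAbs ≤ m ∧ (y : ZMod (2 * m + 1)) = x :=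
  ⟨x.valMinAbs, by have := ZMod.natAbs_valMinAbs_le x; omega, ZMod.coe_valMinAbs x⟩

/-- The permutation of `ℤ / (2 m + 1)` induced by an element of `level m` via the system of
representatives `[-m, m]`. -/
noncomputable def cyclicPerm (m : ℕ) (g : shiftSwapGroup) : Equiv.Perm (ZMod (2 * m + 1)) :=
  if hg : g ∈ level m then
    { toFun := fun x => ((g : Equiv.Perm ℤ) x.valMinAbs : ℤ)
      invFun := fun x => ((g⁻¹ : shiftSwapGroup) : Equiv.Perm ℤ) x.valMinAbs
      left_inv := fun x => by
        obtain ⟨y, hy, rfl⟩ := exists_intCast_eq x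
        simp only
        rw [valMinAbs_intCast hy, valMinAbs_intCast (natAbs_apply_le hg hy)]
        simp
      right_inv := fun x => by
        obtain ⟨y, hy, rfl⟩ := exists_intCast_eq x
        simp only
        rw [valMinAbs_intCast hy, valMinAbs_intCast (natAbs_apply_le ((level m).inv_mem hg) hy)]
        simp }
  else 1

lemma cyclicPerm_apply {m : ℕ} {g : shiftSwapGroup} (hg : g ∈ level m) {y : ℤ}
    (hy : y.natAbs ≤ m) : cyclicPerm m g y = ((g : Equiv.Perm ℤ) y : ℤ) := by
  rw [cyclicPerm, dif_pos hg]
  change (((g : Equiv.Perm ℤ) (y : ZMod (2 * m + 1)).valMinAbs : ℤ) : ZMod (2 * m + 1)) = _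
  rw [valMinAbs_intCast hy]

lemma localRep_cyclicPerm (m : ℕ) :
    filtration.LocalRep m (cyclicPerm m) (Equiv.addRight (1 : ZMod (2 * m + 1))) where
  mul g hg h hh := by
    change g ∈ level m at hg
    change h ∈ level m at hh
    ext x
    obtain ⟨y, hy, rfl⟩ := exists_intCast_eq x
    rw [Equiv.Perm.mul_apply, cyclicPerm_apply ((level m).mul_mem hg hh) hy,
      cyclicPerm_apply hh hy, cyclicPerm_apply hg (natAbs_apply_le hh hy)]
    rfl
  conj g hg h := by
    change g ∈ level m at hg
    change shift * g * shift⁻¹ ∈ level m at h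
    change _ = cyclicPerm m (shift * g * shift⁻¹)
    rw [mul_inv_eq_iff_eq_mul]
    ext x
    obtain ⟨y, hy, rfl⟩ := exists_intCast_eq x
    rw [Equiv.Perm.mul_apply, Equiv.Perm.mul_apply, cyclicPerm_apply hg hy,
      Equiv.coe_addRight]
    beta_reduce
    have e : ((2 * m + 1 : ℕ) : ZMod (2 * m + 1)) = 0 := ZMod.natCast_self _
    push_cast at e
    by_cases hm : y = m
    · have e₁ : (g : Equiv.Perm ℤ) m = m := by
        have := mem_level.1 h (m + 1) (by omega)
        rw [shift_conj_apply, add_sub_cancel_right] at this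
        omega
      have e₂ : (y : ZMod (2 * m + 1)) + 1 = ((-m : ℤ) : ZMod (2 * m + 1)) := by
        rw [hm]
        push_cast
        linear_combination e
      rw [e₂, cyclicPerm_apply h (by omega), shift_conj_apply,
        mem_level.1 hg (-m - 1) (by omega), hm, e₁]
      push_cast
      linear_combination e
    · have e₂ : (y : ZMod (2 * m + 1)) + 1 = ((y + 1 : ℤ) : ZMod (2 * m + 1)) := by push_cast; rfl
      rw [e₂, cyclicPerm_apply h (by omega), shift_conj_apply, add_sub_cancel_right]
      push_cast
      rfl

lemma eventually_extend_cyclicPerm_ne_one {g : shiftSwapGroup} (hg : g ≠ 1) :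
    ∀ᶠ m : ℕ in atTop,
      filtration.extend (cyclicPerm m) (Equiv.addRight (1 : ZMod (2 * m + 1))) g ≠ 1 := by
  obtain ⟨y, hy⟩ : ∃ y, (g : Equiv.Perm ℤ) y ≠ y := by
    by_contra! h
    exact hg (Subtype.ext (Equiv.ext h))
  obtain ⟨a, ha⟩ := filtration.exists_base_mem g
  filter_upwards [eventually_ge_atTop a, eventually_ge_atTop (y + drift g).natAbs,
    eventually_ge_atTop y.natAbs] with m h₁ h₂ h₃ h
  have hbase : filtration.base g ∈ level m := filtration.mono h₁ ha
  have e₁ : (filtration.base g : Equiv.Perm ℤ) (y + drift g) = (g : Equiv.Perm ℤ) y := by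
    change (g : Equiv.Perm ℤ) ((intShift ^ drift g)⁻¹ (y + drift g)) = _
    rw [← zpow_neg, intShift_zpow_apply, add_neg_cancel_right]
  have e₂ := congrArg (fun σ : Equiv.Perm (ZMod (2 * m + 1)) => σ y) h
  have e₃ : (Equiv.addRight (1 : ZMod (2 * m + 1)) ^ drift g) (y : ZMod (2 * m + 1)) =
      ((y + drift g : ℤ) : ZMod (2 * m + 1)) := by
    simp
  change cyclicPerm m (filtration.base g)
    ((Equiv.addRight (1 : ZMod (2 * m + 1)) ^ drift g) (y : ZMod (2 * m + 1))) =
      (y : ZMod (2 * m + 1)) at e₂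
  rw [e₃, cyclicPerm_apply hbase h₂, e₁] at e₂
  have h₄ := natAbs_apply_le hbase h₂
  rw [e₁] at h₄
  have e₄ := congrArg ZMod.valMinAbs e₂
  rw [valMinAbs_intCast h₃, valMinAbs_intCast h₄] at e₄
  exact hy e₄

lemma isSofic : IsSofic shiftSwapGroup := by
  refine isSofic_of_eventually_mul (fun m => Equiv.Perm (ZMod (2 * m + 1)))
    (fun m => filtration.extend (cyclicPerm m) (Equiv.addRight 1)) (fun g h => ?_)
    fun g hg => eventually_extend_cyclicPerm_ne_one hg
  obtain ⟨m₀, hm₀⟩ := filtration.exists_extend_mul g h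
  filter_upwards [eventually_ge_atTop m₀] with m hm
  exact hm₀ m hm _ _ _ (localRep_cyclicPerm m)

end shiftSwapGroup

/-- There is a finitely generated group which is weakly locally stable but not weakly
stable. -/
theorem exists_fg_weaklyLocallyStable_not_weaklyStable :
    ∃ (Γ : Type) (_ : Group Γ),
      Group.FG Γ ∧ IsWeaklyLocallyStable Γ ∧ ¬ IsWeaklyStable Γ :=
  ⟨shiftSwapGroup, inferInstance, inferInstance,
    shiftSwapGroup.filtration.isWeaklyLocallyStable,
    not_isWeaklyStable_of_isSofic shiftSwapGroup.isSofic shiftSwapGroup.swap_commutator_ne_one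
      shiftSwapGroup.map_swap_commutator_eq_one⟩
end
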